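/- arXiv:1509.00420 — 2 statements merged into one kernel-verified Lean document; each statement's English description precedes it below -/
import Mathlib

section
/- Let F be a field, R = F⟨a,b⟩ the free associative F-algebra without identity on a, b, and S the F-linear span of ab and ab². Let m be a natural number and let M be a square matrix with entries in Sᵐ·F[x] ⊆ R[x]. Let c₁, …, c_j be nonzero elements of Sᵐ, and let r = r₁r₂r₃, where for i = 1, 2, 3, r_i is a product of n_i elements from the set C = {c₁, …, c_j} (with n_i ≥ 0, an empty product being omitted). If r ∈ P(M^{n₁+n₂+n₃}), then r_i ∈ P(M^{n_i}) for i = 1, 2, 3. -/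
namespace Paper

noncomputable section

/-- The free unital associative `F`-algebra on two generators `a, b`.  The free
associative algebra *without identity* `F⟨a,b⟩` is its nonunital subalgebra spanned
by all nonempty words in `a, b`, i.e. `NonUnitalAlgebra.adjoin F {a, b}`; its
unitization `R¹` is (identified with) the whole of `FA F`. -/
abbrev FA (F : Type) [Field F] := FreeAlgebra F (Fin 2)

/-- The generator `a`. -/
def aGen (F : Type) [Field F] : FA F := FreeAlgebra.ι F 0

/-- The generator `b`. -/
def bGen (F : Type) [Field F] : FA F := FreeAlgebra.ι F 1

/-- The free nonunital algebra `R = F⟨a,b⟩` inside `FA F`. -/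
def RR (F : Type) [Field F] : NonUnitalSubalgebra F (FA F) :=
  NonUnitalAlgebra.adjoin F {aGen F, bGen F}

/-- The product of two `F`-subspaces: the span of all products `s·t`. -/
def submul {F A : Type*} [Field F] [Ring A] [Algebra F A]
    (S T : Submodule F A) : Submodule F A :=
  Submodule.span F {x : A | ∃ s ∈ S, ∃ t ∈ T, x = s * t}

/-- `spow S n = Sⁿ` for `n ≥ 1`: the span of all `n`-fold products of elements of
`S` (`spow S 0` is set to `S`). -/
def spow {F A : Type*} [Field F] [Ring A] [Algebra F A]
    (S : Submodule F A) : ℕ → Submodule F A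
  | 0 => S
  | 1 => S
  | n + 2 => submul (spow S (n + 1)) S

/-- `S`: the `F`-linear span of `ab` and `ab²`. -/
def SS (F : Type) [Field F] : Submodule F (FA F) :=
  Submodule.span F {aGen F * bGen F, aGen F * (bGen F * bGen F)}

/-- `P(M)`: the `F`-linear span of all coefficients of all the polynomial entries of
the matrix `M`. -/
def coeffSpan {F A : Type*} [Field F] [Ring A] [Algebra F A] {d : ℕ}
    (M : Matrix (Fin d) (Fin d) (Polynomial A)) : Submodule F A :=
  Submodule.span F {x : A | ∃ i j k, x = (M i j).coeff k}

section

variable {F : Type} [Field F]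

theorem submul_eq_mul {A : Type*} [Ring A] [Algebra F A] (S T : Submodule F A) :
    submul S T = S * T := by
  apply le_antisymm
  · refine Submodule.span_le.2 ?_
    rintro _ ⟨s, hs, t, ht, rfl⟩
    exact Submodule.mul_mem_mul hs ht
  · exact Submodule.mul_le.2 fun s hs t ht => Submodule.subset_span ⟨s, hs, t, ht, rfl⟩

theorem coeff_mem_coeffSpan {A : Type*} [Ring A] [Algebra F A] {d : ℕ}
    (M : Matrix (Fin d) (Fin d) (Polynomial A)) (i j : Fin d) (k : ℕ) :
    (M i j).coeff k ∈ coeffSpan (F := F) M :=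
  Submodule.subset_span ⟨i, j, k, rfl⟩

theorem coeffSpan_mul_le {A : Type*} [Ring A] [Algebra F A] {d : ℕ}
    (M N : Matrix (Fin d) (Fin d) (Polynomial A)) :
    coeffSpan (F := F) (M * N) ≤ coeffSpan M * coeffSpan N := by
  refine Submodule.span_le.2 ?_
  rintro _ ⟨i, j, k, rfl⟩
  simp only [Matrix.mul_apply, Polynomial.finsetSum_coeff, Polynomial.coeff_mul]
  exact Submodule.sum_mem _ fun l _ => Submodule.sum_mem _ fun p _ =>
    Submodule.mul_mem_mul (coeff_mem_coeffSpan M i l p.1) (coeff_mem_coeffSpan N l j p.2)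

theorem coeffSpan_pow_le {A : Type*} [Ring A] [Algebra F A] {d : ℕ}
    {M : Matrix (Fin d) (Fin d) (Polynomial A)} {W : Submodule F A}
    (hM : ∀ i j k, (M i j).coeff k ∈ W) (n : ℕ) : coeffSpan (M ^ n) ≤ W ^ n := by
  induction n with
  | zero =>
    refine Submodule.span_le.2 ?_
    rintro _ ⟨i, j, k, rfl⟩
    rw [pow_zero, pow_zero, Matrix.one_apply]
    split_ifs
    · rw [Polynomial.coeff_one]
      split_ifs
      · exact Submodule.one_le.1 le_rfl
      · exact Submodule.zero_mem _
    · exact Submodule.zero_mem _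
  | succ n ih =>
    rw [pow_succ, pow_succ]
    refine (coeffSpan_mul_le _ _).trans (mul_le_mul' ih (Submodule.span_le.2 ?_))
    rintro _ ⟨i, j, k, rfl⟩
    exact hM i j k

/-- Every bilinear map factors, on `A × V`, through multiplication; equivalently, multiplication
`A ⊗ V → A` is injective. -/
def MulFactors {A : Type} [Ring A] [Algebra F A] (V : Submodule F A) : Prop :=
  ∀ (E : Type) [AddCommGroup E] [Module F E] (B : A →ₗ[F] A →ₗ[F] E),
    ∃ Φ : A →ₗ[F] E, ∀ x, ∀ w ∈ V, Φ (x * w) = B x w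

namespace MulFactors

variable {A : Type} [Ring A] [Algebra F A] {U V : Submodule F A}

protected theorem one : MulFactors (1 : Submodule F A) := by
  intro E _ _ B
  refine ⟨B.flip 1, fun x w hw => ?_⟩
  obtain ⟨t, rfl⟩ := Submodule.mem_one.1 hw
  simp [Algebra.algebraMap_eq_smul_one]

protected theorem mul (hU : MulFactors U) (hV : MulFactors V) : MulFactors (U * V) := by
  intro E _ _ B
  obtain ⟨Φ, hΦ⟩ := hU (A →ₗ[F] E)
    (LinearMap.mk₂ F (fun x u => B x ∘ₗ LinearMap.mulLeft F u)
      (by intros; ext; simp) (by intros; ext; simp)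
      (by intros; ext; simp [add_mul]) (by intros; ext; simp))
  obtain ⟨Ψ, hΨ⟩ := hV E Φ
  refine ⟨Ψ, fun x w hw => ?_⟩
  induction hw using Submodule.mul_induction_on' with
  | mem_mul_mem u hu v hv => rw [← mul_assoc, hΨ _ v hv, hΦ x u hu]; simp
  | add y _ z _ hy hz => rw [mul_add, map_add, map_add, hy, hz]

protected theorem pow (hV : MulFactors V) (n : ℕ) : MulFactors (V ^ n) := by
  induction n with
  | zero => rw [pow_zero]; exact .one
  | succ n ih => rw [pow_succ]; exact ih.mul hV

theorem exists_contract (hV : MulFactors V) (g : A →ₗ[F] F) :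
    ∃ Φ : A →ₗ[F] A, ∀ x, ∀ w ∈ V, Φ (x * w) = g w • x := by
  obtain ⟨Φ, hΦ⟩ := hV A ((LinearMap.lsmul F A).flip.compl₂ g)
  exact ⟨Φ, fun x w hw => by simp [hΦ x w hw]⟩

theorem left_mem (hV : MulFactors V) {P Q : Submodule F A} (hQ : Q ≤ V) {u v : A}
    (hv : v ∈ V) (hv0 : v ≠ 0) (h : u * v ∈ P * Q) : u ∈ P := by
  obtain ⟨g, hg⟩ := Module.Projective.exists_dual_ne_zero F hv0
  obtain ⟨Φ, hΦ⟩ := hV.exists_contract g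
  have hle : P * Q ≤ P.comap Φ := Submodule.mul_le.2 fun p hp q hq => by
    rw [Submodule.mem_comap, hΦ p q (hQ hq)]
    exact P.smul_mem _ hp
  have hu := hle h
  rw [Submodule.mem_comap, hΦ u v hv] at hu
  exact (P.smul_mem_iff hg).1 hu

theorem right_mem (hV : MulFactors V) {P Q : Submodule F A} (hQ : Q ≤ V) {u v : A}
    (hv : v ∈ V) (hu0 : u ≠ 0) (h : u * v ∈ P * Q) : v ∈ Q := by
  by_contra hvQ
  obtain ⟨g, hg, hgQ⟩ := Submodule.exists_le_ker_of_notMem hvQ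
  obtain ⟨Φ, hΦ⟩ := hV.exists_contract g
  have hle : P * Q ≤ LinearMap.ker Φ := Submodule.mul_le.2 fun p hp q hq => by
    rw [LinearMap.mem_ker, hΦ p q (hQ hq), LinearMap.mem_ker.1 (hgQ hq), zero_smul]
  have hu := hle h
  rw [LinearMap.mem_ker, hΦ u v hv] at hu
  exact (smul_ne_zero hg hu0) hu

end MulFactors

/-- A linear map on the free algebra may be prescribed independently on the words ending
in each of the letters. -/
theorem exists_linearMap_mul_ι {X E : Type} [AddCommGroup E] [Module F E]
    (D : X → FreeAlgebra F X →ₗ[F] E) :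
    ∃ Φ : FreeAlgebra F X →ₗ[F] E, ∀ x i, Φ (x * FreeAlgebra.ι F i) = D i x := by
  let b := FreeAlgebra.basisFreeMonoid F X
  have hb (w : FreeMonoid X) (i : X) :
      b w * FreeAlgebra.ι F i = b (w * FreeMonoid.of i) := by
    apply (FreeAlgebra.equivMonoidAlgebraFreeMonoid (R := F)).injective
    simp [b, FreeAlgebra.basisFreeMonoid, FreeAlgebra.equivMonoidAlgebraFreeMonoid]
  let f : List X → E
    | [] => 0
    | i :: t => D i (b (FreeMonoid.ofList t.reverse))
  refine ⟨b.constr F fun w => f w.toList.reverse, fun x i => ?_⟩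
  suffices h : b.constr F (fun w => f w.toList.reverse) ∘ₗ
      LinearMap.mulRight F (FreeAlgebra.ι F i) = D i from LinearMap.congr_fun h x
  refine b.ext fun w => ?_
  rw [LinearMap.comp_apply, LinearMap.mulRight_apply, hb, Module.Basis.constr_basis]
  simp [f]

theorem mulFactors_SS : MulFactors (SS F) := by
  intro E _ _ B
  obtain ⟨Ξ, hΞ⟩ := exists_linearMap_mul_ι (F := F) (X := Fin 2)
    ![B.flip (aGen F * (bGen F * bGen F)), 0]
  obtain ⟨Θ, hΘ⟩ := exists_linearMap_mul_ι (F := F) (X := Fin 2)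
    ![B.flip (aGen F * bGen F), Ξ]
  obtain ⟨Φ, hΦ⟩ := exists_linearMap_mul_ι (F := F) (X := Fin 2) ![0, Θ]
  refine ⟨Φ, fun x w hw => ?_⟩
  induction hw using Submodule.span_induction with
  | mem w hw =>
    rcases hw with rfl | rfl
    · rw [← mul_assoc]
      simp [aGen, bGen, hΦ, hΘ]
    · rw [← mul_assoc, ← mul_assoc]
      simp [aGen, bGen, hΦ, hΘ, hΞ]
  | zero => simp
  | add y z _ _ hy hz => rw [mul_add, map_add, map_add, hy, hz]
  | smul t y _ hy => rw [mul_smul_comm, map_smul, map_smul, hy]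

theorem mulFactors_spow_SS : ∀ m : ℕ, MulFactors (spow (SS F) m)
  | 0 => mulFactors_SS
  | 1 => mulFactors_SS
  | n + 2 => by
    rw [spow, submul_eq_mul]
    exact (mulFactors_spow_SS (n + 1)).mul mulFactors_SS

theorem list_prod_map_mem_pow {A X : Type*} [Ring A] [Algebra F A] {W : Submodule F A}
    {c : X → A} (hc : ∀ i, c i ∈ W) (l : List X) : (l.map c).prod ∈ W ^ l.length := by
  induction l with
  | nil => exact Submodule.one_le.1 (pow_zero W).ge
  | cons i l ih =>
    rw [List.map_cons, List.prod_cons, List.length_cons, pow_succ']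
    exact Submodule.mul_mem_mul (hc i) ih

end

/-- Let `R = F⟨a,b⟩`, `S` the span of `ab, ab²`, and `M` a square
matrix with entries in `Sᵐ·F[x]`.  Let `c₁, …, c_j` be nonzero elements of `Sᵐ` and
`r = r₁r₂r₃`, where `rᵢ` is a (nonempty) product of `nᵢ` elements of
`C = {c₁, …, c_j}`.  If `r ∈ P(M^{n₁+n₂+n₃})` then `rᵢ ∈ P(M^{nᵢ})` for `i = 1,2,3`. -/
theorem coeffSpan_factor_mem
    (F : Type) [Field F] (m d : ℕ)
    (M : Matrix (Fin d) (Fin d) (Polynomial (FA F)))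
    (hM : ∀ i j, ∀ k : ℕ, (M i j).coeff k ∈ spow (SS F) m)
    (j : ℕ) (c : Fin j → FA F)
    (hc : ∀ i, c i ∈ spow (SS F) m) (hc0 : ∀ i, c i ≠ 0)
    (l₁ l₂ l₃ : List (Fin j)) (h₁ : l₁ ≠ []) (h₂ : l₂ ≠ []) (h₃ : l₃ ≠ [])
    (hr : ((l₁ ++ l₂ ++ l₃).map c).prod
      ∈ coeffSpan (F := F) (M ^ (l₁.length + l₂.length + l₃.length))) :
    ((l₁.map c).prod ∈ coeffSpan (F := F) (M ^ l₁.length)) ∧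
    ((l₂.map c).prod ∈ coeffSpan (F := F) (M ^ l₂.length)) ∧
    ((l₃.map c).prod ∈ coeffSpan (F := F) (M ^ l₃.length)) := by
  have hW := mulFactors_spow_SS (F := F) m
  have hP := coeffSpan_pow_le hM
  have hmem := list_prod_map_mem_pow hc
  have hne : ∀ l : List (Fin j), (l.map c).prod ≠ 0 := fun l =>
    List.prod_ne_zero fun h => by
      obtain ⟨i, -, hi⟩ := List.mem_map.1 h
      exact hc0 i hi
  rw [List.append_assoc, List.map_append, List.map_append, List.prod_append,
    List.prod_append, add_assoc, pow_add, pow_add] at hr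
  have hle : coeffSpan (F := F) (M ^ l₂.length) * coeffSpan (M ^ l₃.length) ≤
      spow (SS F) m ^ (l₂.length + l₃.length) := by
    rw [pow_add]
    exact mul_le_mul' (hP _) (hP _)
  have hmem₂₃ : (l₂.map c).prod * (l₃.map c).prod ∈
      spow (SS F) m ^ (l₂.length + l₃.length) := by
    rw [pow_add]
    exact Submodule.mul_mem_mul (hmem _) (hmem _)
  have hr₁ := (coeffSpan_mul_le _ _).trans
    (mul_le_mul' le_rfl (coeffSpan_mul_le _ _)) hr
  have hr₂₃ := (hW.pow _).right_mem hle hmem₂₃ (hne l₁) hr₁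
  exact ⟨(hW.pow _).left_mem hle hmem₂₃ (mul_ne_zero (hne l₂) (hne l₃)) hr₁,
    (hW.pow _).left_mem (hP _) (hmem _) (hne l₃) hr₂₃,
    (hW.pow _).right_mem (hP _) (hmem _) (hne l₂) hr₂₃⟩

end

end Paper
end

section
/- Let F be a field and R an associative F-algebra. Let h₁(x), h₂(x), … ∈ R[x] be a family of polynomials and let P be the F-linear span of the set of all coefficients of all the polynomials h_i(x). Then for every nonzero polynomial g(x) ∈ F[x], the F-linear span Q of the set of all coefficients of the polynomials g(x)·h_i(x), i = 1, 2, …, is equal to P. -/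
namespace Paper

/-- Multiplying by a scalar polynomial keeps the coefficients inside a submodule. -/
theorem coeff_map_mul_mem {F R : Type*} [CommSemiring F] [Semiring R] [Algebra F R]
    (S : Submodule F R) (g : Polynomial F) {p : Polynomial R} (hp : ∀ k, p.coeff k ∈ S) (k : ℕ) :
    (g.map (algebraMap F R) * p).coeff k ∈ S := by
  rw [Polynomial.coeff_mul]
  refine S.sum_mem fun x _ => ?_
  rw [Polynomial.coeff_map, ← Algebra.smul_def]
  exact S.smul_mem _ (hp _)

/-- If all coefficients of `g * p` lie in a subspace, with `g` a nonzero scalar polynomial,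
then so do all coefficients of `p`. -/
theorem coeff_mem_of_coeff_map_mul_mem {F R : Type*} [Field F] [Ring R] [Algebra F R]
    (S : Submodule F R) {g : Polynomial F} (hg : g ≠ 0) {p : Polynomial R}
    (hgp : ∀ k, (g.map (algebraMap F R) * p).coeff k ∈ S) (k : ℕ) : p.coeff k ∈ S := by
  induction k using Nat.strong_induction_on with
  | _ k ih =>
    have hc : g.coeff g.natTrailingDegree ≠ 0 := Polynomial.trailingCoeff_nonzero_iff_nonzero.mpr hg
    have hmem := hgp (g.natTrailingDegree + k)
    rw [Polynomial.coeff_mul, ← Finset.add_sum_erase _ _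
      (show (g.natTrailingDegree, k) ∈ Finset.HasAntidiagonal.antidiagonal (g.natTrailingDegree + k) by simp)] at hmem
    rw [S.add_mem_iff_left, Polynomial.coeff_map, ← Algebra.smul_def] at hmem
    · exact (S.smul_mem_iff hc).mp hmem
    · refine S.sum_mem fun x hx => ?_
      obtain ⟨i, j⟩ := x
      simp only [Finset.mem_erase, Finset.HasAntidiagonal.mem_antidiagonal, ne_eq, Prod.mk.injEq] at hx
      rw [Polynomial.coeff_map, ← Algebra.smul_def]
      rcases lt_or_ge i g.natTrailingDegree with hi | hi
      · simp [Polynomial.coeff_eq_zero_of_lt_natTrailingDegree hi]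
      · exact S.smul_mem _ (ih j (by omega))

/-- Let `R` be an associative `F`-algebra and `h₁(x), h₂(x), … ∈ R[x]`
a family of polynomials.  Let `P` be the `F`-linear span of all coefficients of the
`hᵢ`.  Then, for every nonzero `g(x) ∈ F[x]`, the `F`-linear span `Q` of all
coefficients of the polynomials `g(x)·hᵢ(x)` equals `P`. -/
theorem coeff_span_mul_polynomial
    (F : Type) [Field F] (R : Type) [Ring R] [Algebra F R]
    (ι : Type) (h : ι → Polynomial R)
    (P Q : Submodule F R)
    (hP : P = Submodule.span F {x : R | ∃ (i : ι) (k : ℕ), x = (h i).coeff k})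
    (g : Polynomial F) (hg : g ≠ 0)
    (hQ : Q = Submodule.span F
      {x : R | ∃ (i : ι) (k : ℕ), x = (g.map (algebraMap F R) * h i).coeff k}) :
    Q = P := by
  subst hP hQ
  apply le_antisymm <;> rw [Submodule.span_le] <;> rintro _ ⟨i, k, rfl⟩
  · refine coeff_map_mul_mem _ g (fun k => ?_) k
    exact Submodule.subset_span ⟨i, k, rfl⟩
  · refine coeff_mem_of_coeff_map_mul_mem _ hg (fun k => ?_) k
    exact Submodule.subset_span ⟨i, k, rfl⟩

end Paper
end
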